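/- For all m > n ≥ 1, PHP_n^m is (n−1)-extensible w.r.t. HOLES_n^m: for every linear system Ap = b over 𝔽₂ in the variables p_{ij} with fewer than n−1 equations that has a HOLES_n^m-proper solution, and every pigeon i ∈ [m], there exists a HOLES_n^m-proper solution of Ap = b that satisfies the pigeon axiom P_i (i.e., assigns p_{ij} = 1 for some j ∈ [n]). -/

import Mathlib

open Finset

/-- The two-element field. -/
abbrev F2 : Type := ZMod 2

/-- An `F2`-linear form in the variables `V`, given by its coefficients. -/
abbrev LinForm (V : Type) : Type := V → F2

/-- A linear literal: an equation `f = a` where `f` is a linear form and `a ∈ F2`. -/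
abbrev LinLit (V : Type) : Type := LinForm V × F2

/-- A linear clause: a finite disjunction of linear literals. -/
abbrev LinClause (V : Type) : Type := Finset (LinLit V)

/-- A linear system: a finite conjunction of linear equations. -/
abbrev LinSystem (V : Type) : Type := Finset (LinLit V)

/-- A linear CNF formula: a conjunction of linear clauses. -/
abbrev LinCNF (V : Type) : Type := Set (LinClause V)

variable {V : Type}

/-- Evaluation of a linear form at an assignment. -/
def evalForm [Fintype V] (f : LinForm V) (σ : V → F2) : F2 := ∑ v, f v * σ v

/-- The assignment `σ` satisfies the linear equation `l.1 = l.2`. -/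
def LitSat [Fintype V] (σ : V → F2) (l : LinLit V) : Prop := evalForm l.1 σ = l.2

/-- The assignment `σ` satisfies the linear clause `C` (some literal of `C` holds). -/
def ClauseSat [Fintype V] (σ : V → F2) (C : LinClause V) : Prop := ∃ l ∈ C, LitSat σ l

/-- The assignment `σ` is a solution of the linear system `S` (all equations hold). -/
def SysSat [Fintype V] (σ : V → F2) (S : LinSystem V) : Prop := ∀ l ∈ S, LitSat σ l

/-- The assignment `σ` satisfies the linear CNF `φ`. -/
def CNFSat [Fintype V] (σ : V → F2) (φ : LinCNF V) : Prop := ∀ C ∈ φ, ClauseSat σ C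

/-- The linear CNF `φ` is unsatisfiable. -/
def Unsat [Fintype V] (φ : LinCNF V) : Prop := ¬ ∃ σ, CNFSat σ φ

/-- The positive literal `v = 1` for a single variable `v`. -/
def posLit [DecidableEq V] (v : V) : LinLit V := (Pi.single v 1, 1)

/-- The negative literal `v = 0` for a single variable `v`. -/
def negLit [DecidableEq V] (v : V) : LinLit V := (Pi.single v 1, 0)

/-- A solution is `F`-proper if it satisfies every clause of `F`. -/
def FProper [Fintype V] (F : Set (LinClause V)) (σ : V → F2) : Prop := ∀ C ∈ F, ClauseSat σ C

/-- `φ` is `m`-extensible w.r.t. `F`: every linear system with fewer than `m` equations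
that has an `F`-proper solution has, for each clause `C ∈ φ \ F`, an `F`-proper solution
satisfying `C`. -/
def Extensible [Fintype V] (φ : LinCNF V) (F : Set (LinClause V)) (m : ℕ) : Prop :=
  ∀ S : LinSystem V, S.card < m → (∃ σ, SysSat σ S ∧ FProper F σ) →
    ∀ C ∈ φ \ F, ∃ τ, SysSat τ S ∧ FProper F τ ∧ ClauseSat τ C

/-- An assignment to the variables `p_{ij}` is HOLES-proper if it satisfies every hole
axiom, i.e. no hole receives two distinct pigeons. -/
def HolesProper {m n : ℕ} (σ : Fin m × Fin n → F2) : Prop :=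
  ∀ i i' : Fin m, ∀ k : Fin n, i ≠ i' → ¬(σ (i, k) = 1 ∧ σ (i', k) = 1)

/-- The pigeon axiom `P_i = ⋁_{j ∈ [n]} p_{ij}`. -/
def pigeonClause {m n : ℕ} (i : Fin m) : LinClause (Fin m × Fin n) :=
  Finset.univ.image fun j : Fin n => posLit (i, j)

/-- The hole axiom `H_{i i' k} = ¬p_{ik} ∨ ¬p_{i'k}`. -/
def holeClause {m n : ℕ} (i i' : Fin m) (k : Fin n) : LinClause (Fin m × Fin n) :=
  {negLit (i, k), negLit (i', k)}

/-- The pigeonhole principle `PHP_n^m` as a linear CNF. -/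
def PHPCNF (m n : ℕ) : LinCNF (Fin m × Fin n) :=
  {C | ∃ i : Fin m, C = pigeonClause i} ∪
  {C | ∃ (i i' : Fin m) (k : Fin n), i ≠ i' ∧ C = holeClause i i' k}

/-- The linear effect on the equations of `S` of moving pigeon `i`, and nothing else, into the
holes selected by `c`, starting from the assignment `σ`. -/
def redirectMap {m n : ℕ} (S : LinSystem (Fin m × Fin n)) (σ : Fin m × Fin n → F2) (i : Fin m) :
    (Fin n → F2) →ₗ[F2] (S → F2) where
  toFun c l := ∑ v, l.1.1 v * (c v.2 * ((if v.1 = i then 1 else 0) - σ v))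
  map_add' c d := by
    ext l
    simp only [Pi.add_apply, add_mul, mul_add, Finset.sum_add_distrib]
  map_smul' r c := by
    ext l
    simp only [Pi.smul_apply, smul_eq_mul, RingHom.id_apply, Finset.mul_sum]
    exact Finset.sum_congr rfl fun v _ => by ring

/-- For `m > n ≥ 1`, `PHP_n^m` is `(n-1)`-extensible w.r.t. `HOLES_n^m`:
every linear system with fewer than `n-1` equations having a HOLES-proper solution has,
for each pigeon `i`, a HOLES-proper solution satisfying the pigeon axiom `P_i`. -/
theorem php_extensible (m n : ℕ) (hn : 1 ≤ n) (hmn : n < m)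
    (S : LinSystem (Fin m × Fin n)) (hcard : S.card < n - 1)
    (hsol : ∃ σ, SysSat σ S ∧ HolesProper σ) (i : Fin m) :
    ∃ τ, SysSat τ S ∧ HolesProper τ ∧ ∃ j : Fin n, τ (i, j) = 1 := by
  obtain ⟨σ, hσ, hp⟩ := hsol
  have hrank : Module.finrank F2 (S → F2) < Module.finrank F2 (Fin n → F2) := by
    simp only [Module.finrank_fintype_fun_eq_card, Fintype.card_coe, Fintype.card_fin]
    omega
  obtain ⟨c, hc, hc0⟩ := (Submodule.ne_bot_iff _).1
    (LinearMap.ker_ne_bot_of_finrank_lt (f := redirectMap S σ i) hrank)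
  have two (x : F2) : x = 0 ∨ x = 1 := by
    revert x
    decide
  refine ⟨fun v => σ v + c v.2 * ((if v.1 = i then 1 else 0) - σ v), ?_, ?_, ?_⟩
  · intro l hl
    have h : ∑ v, l.1 v * (c v.2 * ((if v.1 = i then 1 else 0) - σ v)) = 0 :=
      congrFun (LinearMap.mem_ker.1 hc) ⟨l, hl⟩
    have h' : ∑ v, l.1 v * σ v = l.2 := hσ l hl
    simp only [LitSat, evalForm, mul_add, Finset.sum_add_distrib, h, h', add_zero]
  · intro a a' k haa' h
    rcases two (c k) with hk | hk
    · exact hp a a' k haa' (by simpa [hk] using h)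
    · have h1 : a = i := by simpa [hk] using h.1
      have h2 : a' = i := by simpa [hk] using h.2
      exact haa' (h1.trans h2.symm)
  · obtain ⟨k, hk⟩ := Function.ne_iff.1 hc0
    exact ⟨k, by simp [(two (c k)).resolve_left hk]⟩
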